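/- arXiv:2306.10259 — 3 statements merged into one kernel-verified Lean document; each statement's English description precedes it below -/
import Mathlib

section
/- Let K ≥ 2, let v : Fin K → ℝ have a unique maximizer i⋆, and for i ≠ i⋆ set Δ_i = v i⋆ − v i > 0. Let a > 0 and T ≥ 1. Consider counts N : ℕ → Fin K → ℕ with N 0 i = 1 for all i, and for each round t ≥ 1 a selected arm k_t ∈ Fin K satisfying k_t ∈ argmax_{i} ( v̂ i (N (t−1) i) + √(a / N (t−1) i) ), with N t i = N (t−1) i + 1 if i = k_t and N t i = N (t−1) i otherwise. Suppose the estimates v̂ : Fin K → ℕ → ℝ satisfy |v̂ i n − v i| ≤ (1/5)·√(a/n) for all i and all n ≥ 1. Then for every t ≤ T and every i ≠ i⋆, N t i ≤ (36/25)·(a/Δ_i²) + 1. -/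
/-- If an arm with `n` samples and gap `Δ = w - u > 0` has a UCB index at least that of an arm of
value `w`, and both estimates are accurate, then `n ≤ (36/25)·a/Δ²`. -/
theorem count_le_of_ucb_index_le {u w x y a n m : ℝ} (huw : u < w) (ha : 0 < a) (hn : 0 < n)
    (hx : |x - u| ≤ (1 / 5) * Real.sqrt (a / n))
    (hy : |y - w| ≤ (1 / 5) * Real.sqrt (a / m))
    (hidx : y + Real.sqrt (a / m) ≤ x + Real.sqrt (a / n)) :
    n ≤ (36 / 25) * (a / (w - u) ^ 2) := by
  have hm := Real.sqrt_nonneg (a / m)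
  have hgap : w - u ≤ (6 / 5) * Real.sqrt (a / n) := by
    linarith [(abs_le.mp hx).2, (abs_le.mp hy).1]
  have hpos : 0 < w - u := sub_pos.mpr huw
  have hsq : (w - u) ^ 2 ≤ (36 / 25) * a / n := by
    calc (w - u) ^ 2 ≤ ((6 / 5) * Real.sqrt (a / n)) ^ 2 := by gcongr
      _ = (36 / 25) * a / n := by
        rw [mul_pow, Real.sq_sqrt (by positivity)]
        ring
  rw [le_div_iff₀ hn] at hsq
  rw [← mul_div_assoc, le_div_iff₀ (by positivity)]
  linarith

/-- Upper-bound induction in the proof of Theorem 5.2: under the good event, the UCB rule with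
index `v̂ i (n) + √(a/n)` (each arm starting with one sample) pulls every suboptimal arm `i`
at most `(36/25)·a/Δ_i² + 1` times in `T` rounds. -/
theorem stmt10 (K : ℕ) (hK : 2 ≤ K) (v : Fin K → ℝ) (istar : Fin K)
    (hmax : ∀ i, i ≠ istar → v i < v istar)
    (a : ℝ) (ha : 0 < a) (T : ℕ) (hT : 1 ≤ T)
    (vhat : Fin K → ℕ → ℝ)
    (hacc : ∀ (i : Fin K) (n : ℕ), 1 ≤ n →
      |vhat i n - v i| ≤ (1 / 5) * Real.sqrt (a / n))
    (N : ℕ → Fin K → ℕ) (hN0 : ∀ i, N 0 i = 1)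
    (k : ℕ → Fin K)
    (hsel : ∀ t, 1 ≤ t → ∀ i : Fin K,
      vhat i (N (t - 1) i) + Real.sqrt (a / N (t - 1) i) ≤
        vhat (k t) (N (t - 1) (k t)) + Real.sqrt (a / N (t - 1) (k t)))
    (hupd : ∀ t, 1 ≤ t → ∀ i : Fin K,
      N t i = if i = k t then N (t - 1) i + 1 else N (t - 1) i) :
    ∀ t ≤ T, ∀ i : Fin K, i ≠ istar →
      (N t i : ℝ) ≤ (36 / 25) * (a / (v istar - v i) ^ 2) + 1 := by
  have hpos : ∀ t i, 1 ≤ N t i := by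
    intro t
    induction t with
    | zero => intro i; exact (hN0 i).ge
    | succ t ih =>
      intro i
      have h := ih i
      rw [hupd (t + 1) t.succ_pos i, Nat.add_sub_cancel]
      split_ifs <;> omega
  intro t ht i hi
  clear ht
  induction t with
  | zero =>
    rw [hN0, Nat.cast_one]
    have : 0 ≤ (36 / 25) * (a / (v istar - v i) ^ 2) := by positivity
    linarith
  | succ t ih =>
    rw [hupd (t + 1) t.succ_pos i, Nat.add_sub_cancel]
    split_ifs with hk
    · have hs := hsel (t + 1) t.succ_pos istar
      rw [Nat.add_sub_cancel, ← hk] at hs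
      push_cast
      gcongr
      exact count_le_of_ucb_index_le (hmax i hi) ha (Nat.cast_pos.mpr (hpos t i))
        (hacc i _ (hpos t i)) (hacc istar _ (hpos t istar)) hs
    · exact ih
end

section
/- Let K ≥ 2, let v : Fin K → ℝ have a unique maximizer i⋆, for i ≠ i⋆ set Δ_i = v i⋆ − v i > 0. Let a > 0 and T ≥ 1. Consider counts N : ℕ → Fin K → ℕ with N 0 i = 1 for all i, and for each round t ≥ 1 a selected arm k_t ∈ argmax_{i} ( v̂ i (N (t−1) i) + √(a / N (t−1) i) ), with N t i = N (t−1) i + 1 if i = k_t and N t i = N (t−1) i otherwise. Suppose |v̂ i n − v i| ≤ (1/5)·√(a/n) for all i and all n ≥ 1. Then for every t ≤ T and every i ≠ i⋆, N t i ≥ (4/25) · min( a/Δ_i², (25/36)·(N t i⋆ − 1) ). -/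
/-- If an index comparison `(4/5)√(a/m) ≤ D + (6/5)√(a/n)` holds, then `m` is at least a constant
multiple of the smaller of `a / D ^ 2` and `n`. -/
theorem mul_min_le_of_sqrt_div_le {a D m n : ℝ} (ha : 0 < a) (hD : 0 < D) (hm : 0 < m)
    (hn : 0 < n) (h : 4 / 5 * √(a / m) ≤ D + 6 / 5 * √(a / n)) :
    4 / 25 * min (a / D ^ 2) (25 / 36 * n) ≤ m := by
  by_contra! hlt
  have hmD : m < 4 / 25 * (a / D ^ 2) :=
    hlt.trans_le (mul_le_mul_of_nonneg_left (min_le_left _ _) (by norm_num))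
  have hmn : m < 4 / 25 * (25 / 36 * n) :=
    hlt.trans_le (mul_le_mul_of_nonneg_left (min_le_right _ _) (by norm_num))
  have hDp : 5 / 2 * D < √(a / m) := by
    apply Real.lt_sqrt_of_sq_lt
    rw [← mul_div_assoc, lt_div_iff₀ (by positivity)] at hmD
    rw [lt_div_iff₀ hm]
    linarith
  have hqp : 3 * √(a / n) < √(a / m) := by
    apply Real.lt_sqrt_of_sq_lt
    rw [mul_pow, Real.sq_sqrt (by positivity), ← mul_div_assoc, div_lt_div_iff₀ hn hm]
    nlinarith
  linarith


/-- Lower-bound induction in the proof of Theorem 5.2: under the good event, the UCB rule with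
index `v̂ i (n) + √(a/n)` (each arm starting with one sample) pulls every suboptimal arm `i`
at least `(4/25)·min(a/Δ_i², (25/36)(N_{i⋆} − 1))` times. -/
theorem stmt11 (K : ℕ) (hK : 2 ≤ K) (v : Fin K → ℝ) (istar : Fin K)
    (hmax : ∀ i, i ≠ istar → v i < v istar)
    (a : ℝ) (ha : 0 < a) (T : ℕ) (hT : 1 ≤ T)
    (vhat : Fin K → ℕ → ℝ)
    (hacc : ∀ (i : Fin K) (n : ℕ), 1 ≤ n →
      |vhat i n - v i| ≤ (1 / 5) * Real.sqrt (a / n))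
    (N : ℕ → Fin K → ℕ) (hN0 : ∀ i, N 0 i = 1)
    (k : ℕ → Fin K)
    (hsel : ∀ t, 1 ≤ t → ∀ i : Fin K,
      vhat i (N (t - 1) i) + Real.sqrt (a / N (t - 1) i) ≤
        vhat (k t) (N (t - 1) (k t)) + Real.sqrt (a / N (t - 1) (k t)))
    (hupd : ∀ t, 1 ≤ t → ∀ i : Fin K,
      N t i = if i = k t then N (t - 1) i + 1 else N (t - 1) i) :
    ∀ t ≤ T, ∀ i : Fin K, i ≠ istar →
      (4 / 25) * min (a / (v istar - v i) ^ 2) ((25 / 36) * ((N t istar : ℝ) - 1)) ≤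
        (N t i : ℝ) := by
  have hpos : ∀ t i, 1 ≤ N t i := by
    intro t
    induction t with
    | zero => intro i; rw [hN0]
    | succ t ih =>
      intro i
      have hi := ih i
      rw [hupd (t + 1) (by omega) i, Nat.add_sub_cancel]
      split_ifs <;> omega
  intro t _ i hi
  clear * - ha hmax hacc hN0 hsel hupd hpos hi
  induction t with
  | zero =>
    have h0 := min_le_right (a / (v istar - v i) ^ 2) ((25 / 36) * ((N 0 istar : ℝ) - 1))
    simp only [hN0, Nat.cast_one, sub_self, mul_zero] at h0 ⊢
    linarith
  | succ t ih =>
    have hs := hsel (t + 1) (by omega) i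
    have hu := hupd (t + 1) (by omega)
    simp only [Nat.add_sub_cancel] at hs hu
    by_cases hk : istar = k (t + 1)
    · have hi' : i ≠ k (t + 1) := hk ▸ hi
      rw [hu i, hu istar, if_neg hi', if_pos hk, Nat.cast_add_one, add_sub_cancel_right]
      rw [← hk] at hs
      have hacc_i := abs_le.mp (hacc i (N t i) (hpos t i))
      have hacc_star := abs_le.mp (hacc istar (N t istar) (hpos t istar))
      exact mul_min_le_of_sqrt_div_le ha (sub_pos.mpr (hmax i hi))
        (Nat.cast_pos.mpr (hpos t i)) (Nat.cast_pos.mpr (hpos t istar)) (by linarith)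
    · rw [hu istar, if_neg hk]
      refine ih.trans (Nat.cast_le.mpr ?_)
      rw [hu i]
      split_ifs <;> omega
end

section
/- Let K ≥ 2, let v : Fin K → ℝ have a unique maximizer i⋆, for i ≠ i⋆ set Δ_i = v i⋆ − v i > 0, and set Δ_{i⋆} = min_{i ≠ i⋆} Δ_i. Let T ≥ K and let a satisfy 0 < a ≤ (25/36)·(T − K) / ( ∑_{i ∈ Fin K} Δ_i^{−2} ). Consider counts N : ℕ → Fin K → ℕ with N 0 i = 1 for all i, and for each round t = 1, …, T a selected arm k_t ∈ argmax_{i} ( v̂ i (N (t−1) i) + √(a / N (t−1) i) ), with N t i = N (t−1) i + 1 if i = k_t and N t i = N (t−1) i otherwise and ∑_i N T i = T + K − 1 replaced by the induced totals. Suppose the estimates satisfy |v̂ i n − v i| ≤ (1/5)·√(a/n) for all i and all n ≥ 1. Then v̂ i⋆ (N T i⋆) ≥ v̂ i (N T i) for every i ∈ Fin K; that is, after T rounds the arm with the largest final estimate is the true best arm i⋆. -/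
/-- If the width `√(a / n)` is at least `x`, then `n` is at most `a / x ^ 2`. -/
theorem le_div_sq_of_le_sqrt {a x n : ℝ} (hx : 0 < x) (hn : 0 < n)
    (h : x ≤ √(a / n)) : n ≤ a / x ^ 2 := by
  have h1 : x ^ 2 ≤ a / n := (Real.le_sqrt' hx).1 h
  rw [le_div_iff₀ hn] at h1
  rw [le_div_iff₀ (by positivity)]
  linarith

/-- If the width `√(a / n)` is at most `x`, then `n` is at least `a / x ^ 2`. -/
theorem div_sq_le_of_sqrt_le {a x n : ℝ} (hx : 0 < x) (hn : 0 < n)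
    (h : √(a / n) ≤ x) : a / x ^ 2 ≤ n := by
  have h1 : a / n ≤ x ^ 2 := (Real.sqrt_le_left hx.le).1 h
  rw [div_le_iff₀ hn] at h1
  rw [div_le_iff₀ (by positivity)]
  linarith

/-- A sample count of at least `(4 / 25) * (a / d ^ 2)` brings the estimation error below `d / 2`. -/
theorem fifth_mul_sqrt_div_le_half {a d n : ℝ} (hd : 0 < d) (hn : 0 < n)
    (h : 4 / 25 * (a / d ^ 2) ≤ n) : 1 / 5 * √(a / n) ≤ d / 2 := by
  have h1 : √(a / n) ≤ 5 / 2 * d := by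
    rw [Real.sqrt_le_left (by positivity), div_le_iff₀ hn]
    rw [← mul_div_assoc, div_le_iff₀ (by positivity)] at h
    linarith
  linarith

/-- Comparing the index of a suboptimal arm (pulled `n` times, gap `d`) with that of the best arm
(pulled `m` times) bounds `n` from below. -/
theorem min_le_of_sqrt_le_add {a d n m : ℝ} (ha : 0 < a) (hd : 0 < d) (hn : 0 < n) (hm : 0 < m)
    (h : 4 / 5 * √(a / n) ≤ d + 6 / 5 * √(a / m)) :
    4 / 25 * min (a / d ^ 2) (25 / 36 * m) ≤ n := by
  rcases le_total (6 / 5 * √(a / m)) d with hc | hc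
  · have h1 : a / (5 / 2 * d) ^ 2 ≤ n := div_sq_le_of_sqrt_le (by positivity) hn (by linarith)
    have h2 : a / (5 / 2 * d) ^ 2 = 4 / 25 * (a / d ^ 2) := by field_simp; norm_num
    linarith [min_le_left (a / d ^ 2) (25 / 36 * m)]
  · have hs : 0 < √(a / m) := Real.sqrt_pos.2 (by positivity)
    have h1 : a / (3 * √(a / m)) ^ 2 ≤ n := div_sq_le_of_sqrt_le (by positivity) hn (by linarith)
    have h2 : a / (3 * √(a / m)) ^ 2 = m / 9 := by
      rw [mul_pow, Real.sq_sqrt (by positivity)]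
      field_simp
      norm_num
    linarith [min_le_right (a / d ^ 2) (25 / 36 * m)]


/-- Deterministic core of Theorem 5.2: under the good event, the UCB rule with index
`v̂ i (n) + √(a/n)` and exploration constant `a ≤ (25/36)(T − K)/∑_i Δ_i⁻²` identifies the best
arm after `T` rounds: the final estimate of `i⋆` is largest. -/
theorem stmt13 (K : ℕ) (hK : 2 ≤ K) (v : Fin K → ℝ) (istar : Fin K)
    (hmax : ∀ i, i ≠ istar → v i < v istar)
    (hne : (Finset.univ.filter (fun i => i ≠ istar)).Nonempty)
    (Δ : Fin K → ℝ)
    (hΔ : ∀ i, i ≠ istar → Δ i = v istar - v i)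
    (hΔstar : Δ istar = (Finset.univ.filter (fun i => i ≠ istar)).inf' hne
        (fun i => v istar - v i))
    (T : ℕ) (hTK : K ≤ T) (hT : 1 ≤ T)
    (a : ℝ) (ha : 0 < a)
    (haUB : a ≤ (25 / 36) * ((T : ℝ) - K) / (∑ i : Fin K, (Δ i ^ 2)⁻¹))
    (vhat : Fin K → ℕ → ℝ)
    (hacc : ∀ (i : Fin K) (n : ℕ), 1 ≤ n →
      |vhat i n - v i| ≤ (1 / 5) * Real.sqrt (a / n))
    (N : ℕ → Fin K → ℕ) (hN0 : ∀ i, N 0 i = 1)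
    (k : ℕ → Fin K)
    (hsel : ∀ t, 1 ≤ t → ∀ i : Fin K,
      vhat i (N (t - 1) i) + Real.sqrt (a / N (t - 1) i) ≤
        vhat (k t) (N (t - 1) (k t)) + Real.sqrt (a / N (t - 1) (k t)))
    (hupd : ∀ t, 1 ≤ t → ∀ i : Fin K,
      N t i = if i = k t then N (t - 1) i + 1 else N (t - 1) i) :
    ∀ i : Fin K, vhat i (N T i) ≤ vhat istar (N T istar) := by
  have hΔpos : ∀ i, i ≠ istar → 0 < Δ i := fun i hi => by
    rw [hΔ i hi]; exact sub_pos.2 (hmax i hi)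
  have hΔstar_le : ∀ i, i ≠ istar → Δ istar ≤ Δ i := fun i hi => by
    rw [hΔ i hi, hΔstar]
    exact Finset.inf'_le _ (by simpa using hi)
  have hΔstar_pos : 0 < Δ istar := by
    rw [hΔstar, Finset.lt_inf'_iff]
    intro i hi
    exact sub_pos.2 (hmax i (by simpa using hi))
  have hΔall : ∀ i, 0 < Δ i := fun i => by
    by_cases hi : i = istar
    · exact hi ▸ hΔstar_pos
    · exact hΔpos i hi
  have hstep : ∀ t i, N (t + 1) i = if i = k (t + 1) then N t i + 1 else N t i :=
    fun t i => hupd (t + 1) (by omega) i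
  have hsel' : ∀ t i, vhat i (N t i) + √(a / N t i) ≤
      vhat (k (t + 1)) (N t (k (t + 1))) + √(a / N t (k (t + 1))) :=
    fun t i => hsel (t + 1) (by omega) i
  have hN1 : ∀ t i, 1 ≤ N t i := by
    intro t
    induction t with
    | zero => intro i; rw [hN0]
    | succ t ih => intro i; rw [hstep]; split_ifs <;> linarith [ih i]
  have hNpos : ∀ t i, (0 : ℝ) < N t i := fun t i => by exact_mod_cast hN1 t i
  have hest : ∀ t i, v i - 1 / 5 * √(a / N t i) ≤ vhat i (N t i) ∧
      vhat i (N t i) ≤ v i + 1 / 5 * √(a / N t i) := fun t i => by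
    have := abs_le.1 (hacc i (N t i) (hN1 t i))
    constructor <;> linarith [this.1, this.2]
  have hupper : ∀ t i, i ≠ istar → (N t i : ℝ) ≤ 36 / 25 * (a / Δ i ^ 2) + 1 := by
    intro t i hi
    have hd := hΔpos i hi
    induction t with
    | zero =>
      have : 0 < a / Δ i ^ 2 := by positivity
      rw [hN0]
      push_cast
      linarith
    | succ t ih =>
      rw [hstep]
      split_ifs with hk
      · have hs := hsel' t istar
        rw [← hk] at hs
        have h1 : 5 / 6 * Δ i ≤ √(a / N t i) := by
          linarith [(hest t istar).1, (hest t i).2, hΔ i hi, Real.sqrt_nonneg (a / N t istar)]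
        have h2 := le_div_sq_of_le_sqrt (by positivity) (hNpos t i) h1
        have h3 : a / (5 / 6 * Δ i) ^ 2 = 36 / 25 * (a / Δ i ^ 2) := by field_simp; norm_num
        push_cast
        linarith
      · exact ih
  have hlower : ∀ t i, i ≠ istar →
      4 / 25 * min (a / Δ i ^ 2) (25 / 36 * ((N t istar : ℝ) - 1)) ≤ N t i := by
    intro t i hi
    induction t with
    | zero =>
      rw [hN0, hN0]
      have := min_le_right (a / Δ i ^ 2) (25 / 36 * (((1 : ℕ) : ℝ) - 1))
      push_cast at this ⊢
      linarith
    | succ t ih =>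
      rw [hstep t i, hstep t istar]
      by_cases hk : istar = k (t + 1)
      · have hs := hsel' t i
        rw [← hk] at hs ⊢
        rw [if_neg hi, if_pos rfl]
        have h1 := min_le_of_sqrt_le_add ha (hΔpos i hi) (hNpos t i) (hNpos t istar)
          (by linarith [(hest t istar).2, (hest t i).1, hΔ i hi])
        push_cast
        rwa [add_sub_cancel_right]
      · rw [if_neg hk]
        refine ih.trans ?_
        split_ifs <;> simp
  have hsum : ∀ t, ∑ i, (N t i : ℝ) = t + K := by
    intro t
    induction t with
    | zero => simp [hN0]
    | succ t ih =>
      have : ∀ i, (N (t + 1) i : ℝ) = N t i + if i = k (t + 1) then 1 else 0 := fun i => by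
        rw [hstep]; split_ifs <;> simp
      simp only [this, Finset.sum_add_distrib, ih]
      simp
      ring
  have hstar : 36 / 25 * (a / Δ istar ^ 2) ≤ (N T istar : ℝ) - 1 := by
    have hS : 0 < ∑ i : Fin K, (Δ i ^ 2)⁻¹ :=
      Finset.sum_pos (fun i _ => inv_pos.2 (pow_pos (hΔall i) 2)) ⟨istar, Finset.mem_univ _⟩
    rw [le_div_iff₀ hS, Finset.mul_sum,
      ← Finset.add_sum_erase _ _ (Finset.mem_univ istar)] at haUB
    have hT' := hsum T
    rw [← Finset.add_sum_erase _ _ (Finset.mem_univ istar)] at hT'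
    have hle : ∑ i ∈ Finset.univ.erase istar, (N T i : ℝ) ≤
        ∑ i ∈ Finset.univ.erase istar, (36 / 25 * (a * (Δ i ^ 2)⁻¹) + 1) :=
      Finset.sum_le_sum fun i hi => hupper T i (Finset.ne_of_mem_erase hi)
    rw [Finset.sum_add_distrib, ← Finset.mul_sum, Finset.sum_const, nsmul_one,
      Finset.card_erase_of_mem (Finset.mem_univ _), Finset.card_univ, Fintype.card_fin,
      Nat.cast_sub (by omega)] at hle
    push_cast at hle
    have hK' : (2 : ℝ) ≤ K := by exact_mod_cast hK
    rw [div_eq_mul_inv a]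
    linarith
  have hgap : ∀ i, i ≠ istar → a / Δ i ^ 2 ≤ a / Δ istar ^ 2 := fun i hi => by
    have := hΔstar_le i hi
    gcongr
  intro i
  by_cases hi : i = istar
  · rw [hi]
  have hNi : 4 / 25 * (a / Δ i ^ 2) ≤ N T i := by
    have h := hlower T i hi
    rwa [min_eq_left (by linarith [hgap i hi])] at h
  have hpos : 0 < a / Δ istar ^ 2 := by positivity
  have e1 := fifth_mul_sqrt_div_le_half (hΔpos i hi) (hNpos T i) hNi
  have e2 := fifth_mul_sqrt_div_le_half hΔstar_pos (hNpos T istar) (a := a) (by linarith)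
  linarith [(hest T i).2, (hest T istar).1, hΔ i hi, hΔstar_le i hi]
end
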